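/- Let 1 ≤ d ≤ 4, let Ω := (ℝ/ℤ)^d be the periodic unit box and let 𝓜 : Ω → S_d^+ be continuous. Then there exists a constant r_0 = r_0(𝓜) > 0 such that: for every z ∈ Ω, every 𝓜(z)-reduced basis (u_1,…,u_d) of ℤ^d, every w ∈ ℝ^d with ‖w‖ ≤ r_0, and every 𝓜(z+w)-reduced mesh 𝒯, the vectors u_1,…,u_d, −u_1,…,−u_d are all vertices of 𝒯. -/

import Mathlib

open Matrix
open scoped BigOperators ENNReal Classical

noncomputable section

/-- Euclidean norm of a vector of `ℝ^d`. -/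
def euclNorm {d : ℕ} (u : Fin d → ℝ) : ℝ := Real.sqrt (u ⬝ᵥ u)

/-- The norm `‖u‖_M := √(uᵀ M u)` associated to a matrix `M`. -/
def normM {d : ℕ} (M : Matrix (Fin d) (Fin d) ℝ) (u : Fin d → ℝ) : ℝ :=
  Real.sqrt (u ⬝ᵥ M.mulVec u)

/-- Operator norm of a matrix, with respect to the euclidean norm. -/
def opNorm {d : ℕ} (M : Matrix (Fin d) (Fin d) ℝ) : ℝ :=
  sSup {r : ℝ | ∃ u : Fin d → ℝ, euclNorm u = 1 ∧ r = euclNorm (M.mulVec u)}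

/-- Anisotropy ratio `κ(M) := max ‖u‖_M/‖v‖_M` over euclidean-unit vectors `u, v`. -/
def kappa {d : ℕ} (M : Matrix (Fin d) (Fin d) ℝ) : ℝ :=
  sSup {r : ℝ | ∃ u v : Fin d → ℝ,
    euclNorm u = 1 ∧ euclNorm v = 1 ∧ r = normM M u / normM M v}

/-- `z` has integer coordinates, i.e. `z ∈ ℤ^d`. -/
def IsIntVec {d : ℕ} (z : Fin d → ℝ) : Prop := ∀ i, ∃ m : ℤ, z i = (m : ℝ)

/-- `z` belongs to the sub-lattice `u_0 ℤ + ⋯ + u_{k-1} ℤ` generated by the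
first `k` vectors of the family `u`. -/
def InLatticeSpan {d : ℕ} (u : Fin d → Fin d → ℝ) (k : ℕ) (z : Fin d → ℝ) : Prop :=
  ∃ c : Fin d → ℤ, (∀ i : Fin d, ¬ ((i : ℕ) < k) → c i = 0) ∧ z = ∑ i, (c i : ℝ) • u i

/-- `u` is an `M`-reduced basis of `ℤ^d`: a basis of the lattice `ℤ^d`
(integer entries, determinant `±1`) such that each `u k` minimizes `‖·‖_M`
among integer vectors outside the sub-lattice spanned by `u 0, …, u (k-1)`. -/
def IsReducedBasis {d : ℕ} (M : Matrix (Fin d) (Fin d) ℝ) (u : Fin d → Fin d → ℝ) : Prop :=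
  (∀ i, IsIntVec (u i)) ∧ |(Matrix.of u).det| = 1 ∧
  ∀ k : Fin d, ∀ z : Fin d → ℝ, IsIntVec z → ¬ InLatticeSpan u (k : ℕ) z →
    normM M (u k) ≤ normM M z

/-- A simplex of `ℝ^d`, described by its vertex set: `d+1` affinely independent points. -/
def IsSimplex (d : ℕ) (V : Finset (Fin d → ℝ)) : Prop :=
  V.card = d + 1 ∧ AffineIndependent ℝ (fun v : V => (v : Fin d → ℝ))

/-- A (conforming) mesh: a finite collection of simplices such that the intersection
of any two of them is the convex hull of their common vertices. -/
def IsMesh (d : ℕ) (𝒯 : Finset (Finset (Fin d → ℝ))) : Prop :=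
  (∀ V ∈ 𝒯, IsSimplex d V) ∧
  ∀ S ∈ 𝒯, ∀ T ∈ 𝒯,
    (convexHull ℝ (S : Set (Fin d → ℝ))) ∩ (convexHull ℝ (T : Set (Fin d → ℝ)))
      = convexHull ℝ ((S ∩ T : Finset (Fin d → ℝ)) : Set (Fin d → ℝ))

/-- An `M`-reduced mesh. -/
def IsReducedMesh {d : ℕ} (M : Matrix (Fin d) (Fin d) ℝ)
    (𝒯 : Finset (Finset (Fin d → ℝ))) : Prop :=
  IsMesh d 𝒯 ∧
  (⋃ V ∈ 𝒯, convexHull ℝ (V : Set (Fin d → ℝ))) ∈ nhds (0 : Fin d → ℝ) ∧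
  (∀ V ∈ 𝒯, ∀ v ∈ V, IsIntVec v) ∧
  (∀ V ∈ 𝒯, MeasureTheory.volume (convexHull ℝ (V : Set (Fin d → ℝ)))
      = ENNReal.ofReal (1 / (Nat.factorial d))) ∧
  (∀ V ∈ 𝒯, (0 : Fin d → ℝ) ∈ V) ∧
  (∀ V ∈ 𝒯, ∀ v ∈ V, ∀ w ∈ V, v ≠ 0 → w ≠ 0 → 0 ≤ v ⬝ᵥ M.mulVec w)

/-- `z` is a vertex of the mesh `𝒯`. -/
def IsMeshVertex {d : ℕ} (𝒯 : Finset (Finset (Fin d → ℝ))) (z : Fin d → ℝ) : Prop :=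
  ∃ V ∈ 𝒯, z ∈ V

/-- The multiplicative distance `d_×(M,N) := sup_{u ≠ 0} |ln ‖u‖_M − ln ‖u‖_N|`. -/
def dTimes {d : ℕ} (M N : Matrix (Fin d) (Fin d) ℝ) : ℝ :=
  sSup {r : ℝ | ∃ u : Fin d → ℝ, u ≠ 0 ∧ r = |Real.log (normM M u) - Real.log (normM N u)|}

/-- The periodic unit box `Ω = (ℝ/ℤ)^d`. -/
abbrev Torus (d : ℕ) : Type := Fin d → AddCircle (1 : ℝ)

/-- Canonical projection `ℝ^d → (ℝ/ℤ)^d`. -/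
def toTorus {d : ℕ} (x : Fin d → ℝ) : Torus d := fun i => (x i : AddCircle (1 : ℝ))

/-- The grid `Ω_n = {0, 1/n, …, (n-1)/n}^d ⊂ Ω`. -/
def IsGridPoint {d : ℕ} (n : ℕ) (z : Torus d) : Prop :=
  ∃ k : Fin d → ℤ, ∀ i, z i = (((k i : ℝ) / (n : ℝ) : ℝ) : AddCircle (1 : ℝ))

/-- The quotient (periodic) distance on the torus. -/
def dPer {d : ℕ} (z x : Torus d) : ℝ :=
  sInf {r : ℝ | ∃ Z X : Fin d → ℝ, toTorus Z = z ∧ toTorus X = x ∧ r = euclNorm (Z - X)}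

/-- The Hopf–Lax update operator associated to the matrix `M`, the stencil (mesh) `𝒯`,
and the grid scale `1/n`: minimum over simplices `T ∈ 𝒯`, and over barycentric
coefficients `α ≥ 0` supported on the nonzero vertices of `T` with total mass 1, of
`‖∑ α_v v/n‖_M + ∑ α_v u(z + v/n)` (with the convention `0·∞ = 0`). -/
def hopfLax {d : ℕ} (M : Matrix (Fin d) (Fin d) ℝ) (𝒯 : Finset (Finset (Fin d → ℝ)))
    (n : ℕ) (u : Torus d → ℝ≥0∞) (z : Torus d) : ℝ≥0∞ :=
  ⨅ (T : Finset (Fin d → ℝ)) (_ : T ∈ 𝒯) (α : (Fin d → ℝ) → ℝ)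
    (_ : ∀ w, 0 ≤ α w) (_ : α 0 = 0) (_ : ∑ w ∈ T, α w = 1),
    ENNReal.ofReal (normM M ((n : ℝ)⁻¹ • ∑ w ∈ T, α w • w)) +
      ∑ w ∈ T, ENNReal.ofReal (α w) * u (z + toTorus ((n : ℝ)⁻¹ • w))

/-- `u` solves the discrete fixed point system: `u(0) = 0` and
`u(z) = Λ_n(u,z)` at every other grid point `z`. -/
def SolvesDiscrete {d : ℕ} (𝓜 : Torus d → Matrix (Fin d) (Fin d) ℝ)
    (𝒯 : Torus d → Finset (Finset (Fin d → ℝ))) (n : ℕ) (u : Torus d → ℝ≥0∞) : Prop :=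
  u 0 = 0 ∧ ∀ z : Torus d, IsGridPoint n z → z ≠ 0 → u z = hopfLax (𝓜 z) (𝒯 z) n u z


theorem qsum {d : ℕ} (A : Matrix (Fin d) (Fin d) ℝ) (x : Fin d → ℝ) (ε : ℝ)
    (h : ∀ i j, |A i j| ≤ ε) : |x ⬝ᵥ A.mulVec x| ≤ (d:ℝ)^2 * ε * ‖x‖^2 := by
  have : x ⬝ᵥ A.mulVec x = ∑ i, ∑ j, x i * (A i j * x j) := by
    simp [dotProduct, Matrix.mulVec, Finset.mul_sum]
  rw [this]
  calc |∑ i, ∑ j, x i * (A i j * x j)| ≤ ∑ i, ∑ j, |x i * (A i j * x j)| :=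
        (Finset.abs_sum_le_sum_abs _ _).trans
          (Finset.sum_le_sum fun i _ => Finset.abs_sum_le_sum_abs _ _)
    _ ≤ ∑ i : Fin d, ∑ j : Fin d, ‖x‖ * (ε * ‖x‖) := by
        refine Finset.sum_le_sum fun i _ => Finset.sum_le_sum fun j _ => ?_
        rw [abs_mul, abs_mul]
        have h1 : |x i| ≤ ‖x‖ := norm_le_pi_norm x i
        have h2 : |x j| ≤ ‖x‖ := norm_le_pi_norm x j
        have := h i j
        have := (abs_nonneg _).trans this
        gcongr
    _ = _ := by simp; ring

theorem lower {d : ℕ} (hd : 1 ≤ d) (𝓜 : Torus d → Matrix (Fin d) (Fin d) ℝ)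
    (hcont : Continuous 𝓜) (hpd : ∀ z, (𝓜 z).PosDef) :
    ∃ c : ℝ, 0 < c ∧ ∀ z x, c * ‖x‖^2 ≤ x ⬝ᵥ (𝓜 z).mulVec x := by
  have : Nonempty (Fin d) := ⟨⟨0, hd⟩⟩
  let K : Set (Torus d × (Fin d → ℝ)) := Set.univ ×ˢ Metric.sphere 0 1
  have hK : IsCompact K := isCompact_univ.prod (isCompact_sphere _ _)
  have hne : K.Nonempty := by
    have : (Metric.sphere (0 : Fin d → ℝ) 1).Nonempty := NormedSpace.sphere_nonempty.2 zero_le_one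
    exact Set.univ_nonempty.prod this
  have hf : Continuous (fun p : Torus d × (Fin d → ℝ) => p.2 ⬝ᵥ (𝓜 p.1).mulVec p.2) := by
    apply Continuous.dotProduct continuous_snd
    exact Continuous.matrix_mulVec (hcont.comp continuous_fst) continuous_snd
  obtain ⟨p, hp, hmin⟩ := hK.exists_isMinOn hne hf.continuousOn
  have hp2 : p.2 ≠ 0 := by
    intro h
    have := hp.2
    simp [h] at this
  refine ⟨_, by simpa using (hpd p.1).dotProduct_mulVec_pos hp2, fun z x => ?_⟩
  by_cases hx : x = 0
  · simp [hx]
  have hn : 0 < ‖x‖ := norm_pos_iff.2 hx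
  have h := hmin (show (z, ‖x‖⁻¹ • x) ∈ K from ⟨trivial, by simp [norm_smul, hn.ne']⟩)
  simp only [Set.mem_ofPred_eq, Matrix.mulVec_smul, dotProduct_smul, smul_dotProduct, smul_eq_mul] at h
  calc _ ≤ (‖x‖⁻¹ * (‖x‖⁻¹ * x ⬝ᵥ 𝓜 z *ᵥ x)) * ‖x‖^2 := by gcongr
    _ = _ := by field_simp

theorem int_norm {d : ℕ} (x : Fin d → ℝ) (hx : IsIntVec x) (h0 : x ≠ 0) : 1 ≤ ‖x‖ := by
  obtain ⟨i, hi⟩ := Function.ne_iff.1 h0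
  refine le_trans ?_ (norm_le_pi_norm x i)
  obtain ⟨m, hm⟩ := hx i
  rw [hm] at hi ⊢
  have : m ≠ 0 := by rintro rfl; simp at hi
  rw [Real.norm_eq_abs]
  exact_mod_cast Int.one_le_abs this

theorem unif {d : ℕ} (𝓜 : Torus d → Matrix (Fin d) (Fin d) ℝ)
    (hcont : Continuous 𝓜) (ε : ℝ) (hε : 0 < ε) :
    ∃ r : ℝ, 0 < r ∧ ∀ z w, euclNorm w ≤ r → ∀ i j, |𝓜 (z + toTorus w) i j - 𝓜 z i j| ≤ ε := by
  let g : Torus d → Fin d → Fin d → ℝ := fun z i j => 𝓜 z i j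
  have hg : Continuous g := hcont
  obtain ⟨δ, hδ, h⟩ := Metric.uniformContinuous_iff.1
    (CompactSpace.uniformContinuous_of_continuous hg) ε hε
  refine ⟨δ/2, by positivity, fun z w hw i j => ?_⟩
  have hd : dist (z + toTorus w) z < δ := by
    rw [dist_eq_norm, add_sub_cancel_left]
    refine lt_of_le_of_lt ?_ (half_lt_self hδ)
    rw [pi_norm_le_iff_of_nonneg (by positivity)]
    intro k
    refine le_trans ?_ hw
    have h1 : ‖toTorus w k‖ ≤ ‖w k‖ := QuotientAddGroup.norm_mk_le_norm
    refine h1.trans ?_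
    rw [Real.norm_eq_abs, euclNorm]
    apply Real.abs_le_sqrt
    rw [dotProduct, sq]
    exact Finset.single_le_sum (f := fun i => w i * w i) (fun i _ => mul_self_nonneg _) (Finset.mem_univ k)
  have := h hd
  have h1 := (dist_le_pi_dist _ _ i).trans_lt this
  have h2 := (dist_le_pi_dist _ _ j).trans_lt h1
  exact h2.le

theorem upper {d : ℕ} (𝓜 : Torus d → Matrix (Fin d) (Fin d) ℝ)
    (hcont : Continuous 𝓜) :
    ∃ C : ℝ, 0 < C ∧ ∀ z x, x ⬝ᵥ (𝓜 z).mulVec x ≤ C * ‖x‖^2 := by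
  let g : Torus d → Fin d → Fin d → ℝ := fun z i j => 𝓜 z i j
  have hg : Continuous g := hcont
  obtain ⟨B, hB⟩ := isCompact_univ.exists_bound_of_continuousOn hg.continuousOn
  refine ⟨d^2 * |B| + 1, by positivity, fun z x => ?_⟩
  have := qsum (𝓜 z) x |B| (fun i j => by
    have h := (hB z trivial).trans (le_abs_self B)
    exact ((norm_le_pi_norm (g z i) j).trans (norm_le_pi_norm (g z) i)).trans h)
  nlinarith [le_abs_self (x ⬝ᵥ (𝓜 z).mulVec x), sq_nonneg ‖x‖]

theorem span_sum {d : ℕ} (u : Fin d → Fin d → ℝ) (k : ℕ) (n : Fin d → ℤ) (b : Fin d → Fin d → ℝ)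
    (h : ∀ j, n j ≠ 0 → InLatticeSpan u k (b j)) :
    InLatticeSpan u k (∑ j, (n j : ℝ) • b j) := by
  have h' : ∀ j, InLatticeSpan u k ((n j : ℝ) • b j) := by
    intro j
    by_cases hj : n j = 0
    · exact ⟨0, by simp, by simp [hj]⟩
    · obtain ⟨c, hc, hb⟩ := h j hj
      refine ⟨fun i => n j * c i, fun i hi => by simp [hc i hi], ?_⟩
      rw [hb, Finset.smul_sum]
      simp [smul_smul]
  choose c hc hb using h'
  refine ⟨fun i => ∑ j, c j i, fun i hi => Finset.sum_eq_zero fun j _ => hc j i hi, ?_⟩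
  simp_rw [hb]
  rw [Finset.sum_comm]
  simp [Finset.sum_smul]

theorem not_span {d : ℕ} (u : Fin d → Fin d → ℝ) (hu : |(Matrix.of u).det| = 1) (i : Fin d) :
    ¬ InLatticeSpan u i (u i) := by
  rintro ⟨c, hc, h⟩
  have hdet : (Matrix.of u).det ≠ 0 := by intro h; simp [h] at hu
  have : (Pi.single i 1 - fun i => (c i : ℝ)) ᵥ* (Matrix.of u) = 0 := by
    rw [Matrix.sub_vecMul, sub_eq_zero]
    ext j
    have := congrFun h j
    simp only [Finset.sum_apply, Pi.smul_apply, smul_eq_mul] at this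
    rw [Matrix.single_one_vecMul]
    simpa [Matrix.vecMul, dotProduct] using this
  have := congrFun (Matrix.eq_zero_of_vecMul_eq_zero hdet this) i
  simp [hc i (lt_irrefl _)] at this

/-- Solid standard simplex. -/
def solid (d : ℕ) : Set (Fin d → ℝ) := {x | (∀ i, 0 ≤ x i) ∧ ∑ i, x i ≤ 1}

theorem solid_vol (d : ℕ) :
    ENNReal.ofReal (1 / (Nat.factorial d)) ≤ MeasureTheory.volume (solid d) := by
  have h := MeasureTheory.volume_sum_rpow_lt_one (Fin d) (le_refl (1:ℝ))
  simp only [Fintype.card_fin, Real.rpow_one, div_one] at h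
  rw [one_add_one_eq_two, Real.Gamma_two, mul_one, Real.Gamma_nat_eq_factorial] at h
  have hsub : {x : Fin d → ℝ | ∑ i, |x i| < 1} ⊆
      ⋃ s : Fin d → Bool, (Matrix.toLin' (Matrix.diagonal fun i => if s i then (1:ℝ) else -1)) '' solid d := by
    intro x hx
    refine Set.mem_iUnion.2 ⟨fun i => decide (0 ≤ x i), fun i => |x i|, ⟨fun i => abs_nonneg _, le_of_lt hx⟩, ?_⟩
    ext i
    simp only [Matrix.toLin'_apply, Matrix.mulVec_diagonal]
    by_cases h : 0 ≤ x i
    · simp [h, abs_of_nonneg]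
    · simp [h, abs_of_neg (not_le.1 h)]
  have h2 := (MeasureTheory.measure_mono (μ := MeasureTheory.volume) hsub).trans
    (MeasureTheory.measure_iUnion_le _)
  rw [h, tsum_fintype] at h2
  simp only [MeasureTheory.Measure.addHaar_image_linearMap, LinearMap.det_toLin',
    Matrix.det_diagonal, Finset.abs_prod] at h2
  have h3 : ∀ s : Fin d → Bool, ∏ i, |if s i then (1:ℝ) else -1| = 1 := by
    intro s
    apply Finset.prod_eq_one
    intro i _
    split_ifs <;> simp
  simp only [h3, ENNReal.ofReal_one, one_mul, Finset.sum_const, Finset.card_univ,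
    Fintype.card_fun, Fintype.card_bool, Fintype.card_fin, nsmul_eq_mul] at h2
  rw [show (2:ℝ)^d / (d.factorial : ℝ) = 2^d * (1 / d.factorial) by ring,
    ENNReal.ofReal_mul (by positivity)] at h2
  rw [show ENNReal.ofReal ((2:ℝ)^d) = ((2^d : ℕ) : ℝ≥0∞) by
    rw [← ENNReal.ofReal_natCast]; simp] at h2
  exact (ENNReal.mul_le_mul_iff_right (by positivity) (by simp)).1 h2

theorem hull_eq {d : ℕ} (V : Finset (Fin d → ℝ)) (b : Fin d → Fin d → ℝ) (h0 : 0 ∈ V)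
    (hb : ∀ i, b i ∈ V) (hV : ∀ v ∈ V, v ≠ 0 → ∃ i, b i = v) :
    convexHull ℝ (V : Set (Fin d → ℝ)) = (Matrix.toLin' (Matrix.of b)ᵀ) '' solid d := by
  apply Set.Subset.antisymm
  · apply convexHull_min
    · intro v hv
      by_cases h : v = 0
      · exact ⟨0, ⟨by simp, by simp⟩, by simp [h]⟩
      · obtain ⟨i, rfl⟩ := hV v hv h
        refine ⟨Pi.single i 1, ⟨fun j => ?_, by simp⟩, ?_⟩
        · by_cases h : j = i
          · subst h; simp
          · simp [h]
        · ext j; simp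
    · apply Convex.linear_image
      intro x hx y hy a b ha hb hab
      refine ⟨fun i => ?_, ?_⟩
      · have := hx.1 i
        have := hy.1 i
        simp only [Pi.add_apply, Pi.smul_apply, smul_eq_mul]
        positivity
      · simp only [Pi.add_apply, Pi.smul_apply, smul_eq_mul, Finset.sum_add_distrib, ← Finset.mul_sum]
        nlinarith [hx.2, hy.2]
  · rintro _ ⟨y, ⟨hy, hs⟩, rfl⟩
    have := (convex_convexHull ℝ (V : Set (Fin d → ℝ))).sum_mem (t := Finset.univ)
      (w := (Fin.cons (1 - ∑ i, y i) y : Fin (d+1) → ℝ))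
      (z := (Fin.cons 0 b : Fin (d+1) → Fin d → ℝ)) ?_ ?_ ?_
    · rw [Fin.sum_univ_succ] at this
      convert this using 1
      ext j
      simp [Matrix.mulVec, dotProduct, mul_comm]
    · intro i _
      refine Fin.cases ?_ ?_ i
      · simpa using hs
      · simpa using hy
    · rw [Fin.sum_univ_succ]; simp
    · intro i _
      apply subset_convexHull
      refine Fin.cases ?_ ?_ i
      · simpa using h0
      · simpa using hb

theorem cone {d : ℕ} (M : Matrix (Fin d) (Fin d) ℝ) (𝒯 : Finset (Finset (Fin d → ℝ)))
    (hT : IsReducedMesh M 𝒯) (u : Fin d → ℝ) (hu : IsIntVec u) :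
    ∃ V ∈ 𝒯, ∃ b : Fin d → Fin d → ℝ, (∀ i, b i ∈ V ∧ b i ≠ 0) ∧
      ∃ n : Fin d → ℤ, (∀ i, 0 ≤ n i) ∧ u = ∑ i, (n i : ℝ) • b i := by
  obtain ⟨⟨hsimp, -⟩, hnhd, hint, hvol, hzero, -⟩ := hT
  have ht : ∀ᶠ t : ℝ in nhdsWithin 0 (Set.Ioi 0),
      t • u ∈ ⋃ V ∈ 𝒯, convexHull ℝ (V : Set (Fin d → ℝ)) := by
    have : Filter.Tendsto (fun t : ℝ => t • u) (nhdsWithin 0 (Set.Ioi 0)) (nhds 0) := by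
      have h : Continuous (fun t : ℝ => t • u) := by fun_prop
      have := h.tendsto 0
      rw [zero_smul] at this
      exact this.mono_left nhdsWithin_le_nhds
    exact this hnhd
  obtain ⟨t, htu, ht0⟩ := (ht.and self_mem_nhdsWithin).exists
  simp only [Set.mem_iUnion] at htu
  obtain ⟨V, hV, htV⟩ := htu
  have h0 := hzero V hV
  have hcard : (V.erase 0).card = d := by
    rw [Finset.card_erase_of_mem h0, (hsimp V hV).1]; rfl
  let e := (V.erase 0).equivFinOfCardEq hcard
  let b : Fin d → Fin d → ℝ := fun i => (e.symm i : Fin d → ℝ)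
  have hb : ∀ i, b i ∈ V ∧ b i ≠ 0 := fun i => by
    have := (e.symm i).2
    rw [Finset.mem_erase] at this
    exact ⟨this.2, this.1⟩
  have hsurj : ∀ v ∈ V, v ≠ 0 → ∃ i, b i = v := fun v hv hv0 =>
    ⟨e ⟨v, Finset.mem_erase.2 ⟨hv0, hv⟩⟩, by simp [b]⟩
  have heq := hull_eq V b h0 (fun i => (hb i).1) hsurj
  have hv := hvol V hV
  rw [heq, MeasureTheory.Measure.addHaar_image_linearMap, LinearMap.det_toLin',
    Matrix.det_transpose] at hv
  have hfac : (0:ℝ) < 1 / (Nat.factorial d) := by positivity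
  have hdet0 : (Matrix.of b).det ≠ 0 := by
    intro h
    rw [h, abs_zero, ENNReal.ofReal_zero, zero_mul] at hv
    exact (ENNReal.ofReal_pos.2 hfac).ne hv
  have hdet1 : |(Matrix.of b).det| ≤ 1 := by
    have h1 := (mul_le_mul_right (solid_vol d) (ENNReal.ofReal |(Matrix.of b).det|)).trans_eq hv
    rw [← ENNReal.ofReal_mul (abs_nonneg _), ENNReal.ofReal_le_ofReal_iff hfac.le] at h1
    exact le_of_mul_le_mul_right (by simpa using h1) hfac
  have hbint : ∀ i j, ∃ m : ℤ, b i j = m := fun i => hint V hV _ (hb i).1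
  choose N hN using hbint
  choose m hm using hu
  have hmap : Matrix.of b = (Matrix.of N).map (Int.castRingHom ℝ) := by
    ext i j; simp [hN]
  have hdN : (Matrix.of b).det = ((Matrix.of N).det : ℤ) := by
    rw [hmap]; exact (RingHom.map_det (Int.castRingHom ℝ) (Matrix.of N)).symm
  have hunit : IsUnit (Matrix.of N).det := by
    rw [hdN] at hdet0 hdet1
    have h1 : |(Matrix.of N).det| ≤ 1 := by exact_mod_cast hdet1
    have h0 : (Matrix.of N).det ≠ 0 := by exact_mod_cast hdet0
    exact Int.isUnit_iff_abs_eq.2 (le_antisymm h1 (Int.one_le_abs h0))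
  rw [heq] at htV
  obtain ⟨y, ⟨hy, -⟩, hyu⟩ := htV
  let n := m ᵥ* (Matrix.of N)⁻¹
  have hn : n ᵥ* Matrix.of N = m := by
    simp [n, Matrix.vecMul_vecMul, Matrix.nonsing_inv_mul _ hunit]
  have hnu : (fun i => (n i : ℝ)) ᵥ* Matrix.of b = u := by
    ext j
    have := congrArg (fun k : ℤ => (k : ℝ)) (congrFun hn j)
    simp only [Matrix.vecMul, dotProduct, Matrix.of_apply] at this ⊢
    push_cast at this
    rw [hm, ← this]
    simp [hN]
  have hyt : (y - t • fun i => (n i : ℝ)) ᵥ* Matrix.of b = 0 := by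
    rw [Matrix.sub_vecMul, Matrix.smul_vecMul, hnu, sub_eq_zero, ← hyu]
    simp [Matrix.mulVec_transpose]
  have hyn := Matrix.eq_zero_of_vecMul_eq_zero hdet0 hyt
  refine ⟨V, hV, b, hb, n, fun i => ?_, ?_⟩
  · have h1 := congrFun hyn i
    simp at h1
    have h2 := hy i
    have h3 : (0:ℝ) ≤ n i := by
      rw [sub_eq_zero.1 h1] at h2
      exact nonneg_of_mul_nonneg_right h2 ht0
    exact_mod_cast h3
  · rw [← hnu]
    ext j
    simp [Matrix.vecMul, dotProduct]

theorem key {d : ℕ} (M : Matrix (Fin d) (Fin d) ℝ) (𝒯 : Finset (Finset (Fin d → ℝ)))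
    (hT : IsReducedMesh M 𝒯) (y : Fin d → ℝ) (hy : IsIntVec y) (u : Fin d → Fin d → ℝ) (k : ℕ)
    (hs : ¬ InLatticeSpan u k y) (hnv : ¬ IsMeshVertex 𝒯 y) :
    ∃ v r : Fin d → ℝ, IsIntVec v ∧ IsIntVec r ∧ r ≠ 0 ∧ ¬ InLatticeSpan u k v ∧
      v ⬝ᵥ M.mulVec v + r ⬝ᵥ M.mulVec r ≤ y ⬝ᵥ M.mulVec y := by
  obtain ⟨V, hV, b, hb, n, hn, hyn⟩ := cone M 𝒯 hT y hy
  have hex : ∃ j, n j ≠ 0 ∧ ¬ InLatticeSpan u k (b j) := by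
    by_contra! h
    exact hs (hyn ▸ span_sum u k n b h)
  obtain ⟨j, hj, hbj⟩ := hex
  have hint := hT.2.2.1 V hV
  have hac := hT.2.2.2.2.2 V hV
  have hr : y - b j = ∑ i, ((n i : ℝ) - if i = j then 1 else 0) • b i := by
    simp [sub_smul, Finset.sum_sub_distrib, ← hyn]
  have hco : ∀ i, (0:ℝ) ≤ (n i : ℝ) - if i = j then 1 else 0 := by
    intro i
    split_ifs with h
    · subst h
      have : 1 ≤ n i := by have := hn i; omega
      have : (1:ℝ) ≤ n i := by exact_mod_cast this
      linarith
    · simpa using hn i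
  refine ⟨b j, y - b j, hint _ (hb j).1, fun i => ?_, ?_, hbj, ?_⟩
  · obtain ⟨p, hp⟩ := hy i
    obtain ⟨q, hq⟩ := hint _ (hb j).1 i
    exact ⟨p - q, by simp [hp, hq]⟩
  · intro h
    exact hnv ⟨V, hV, by rw [sub_eq_zero.1 h]; exact (hb j).1⟩
  · have h1 : 0 ≤ b j ⬝ᵥ M.mulVec (y - b j) := by
      rw [hr, Matrix.mulVec_sum, dotProduct_sum]
      refine Finset.sum_nonneg fun i _ => ?_
      rw [Matrix.mulVec_smul, dotProduct_smul]
      exact mul_nonneg (hco i) (hac _ (hb j).1 _ (hb i).1 (hb j).2 (hb i).2)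
    have h2 : 0 ≤ (y - b j) ⬝ᵥ M.mulVec (b j) := by
      rw [hr, sum_dotProduct]
      refine Finset.sum_nonneg fun i _ => ?_
      rw [smul_dotProduct]
      exact mul_nonneg (hco i) (hac _ (hb i).1 _ (hb j).1 (hb i).2 (hb j).2)
    simp only [Matrix.mulVec_sub, dotProduct_sub, sub_dotProduct] at h1 h2 ⊢
    linarith

/-- Lemma `assums` (Consistency): for a continuous Riemannian metric `𝓜` on the torus,
`1 ≤ d ≤ 4`, there is `r₀ > 0` such that any `𝓜(z)`-reduced basis, and its opposite,
consists of vertices of any `𝓜(z+w)`-reduced mesh whenever `‖w‖ ≤ r₀`. -/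
theorem stmt13 {d : ℕ} (hd1 : 1 ≤ d) (hd4 : d ≤ 4)
    (𝓜 : Torus d → Matrix (Fin d) (Fin d) ℝ) (hcont : Continuous 𝓜)
    (hpd : ∀ z, (𝓜 z).PosDef) :
    ∃ r₀ : ℝ, 0 < r₀ ∧
      ∀ z : Torus d, ∀ u : Fin d → Fin d → ℝ, IsReducedBasis (𝓜 z) u →
        ∀ w : Fin d → ℝ, euclNorm w ≤ r₀ →
          ∀ 𝒯 : Finset (Finset (Fin d → ℝ)), IsReducedMesh (𝓜 (z + toTorus w)) 𝒯 →
            ∀ i : Fin d, IsMeshVertex 𝒯 (u i) ∧ IsMeshVertex 𝒯 (-(u i)) := by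
  obtain ⟨c, hc, hlow⟩ := lower hd1 𝓜 hcont hpd
  obtain ⟨C, hC, hup⟩ := upper 𝓜 hcont
  -- bounds: ‖u‖² ≤ C/c, ‖v‖² ≤ C²/c²
  let A := C / c + C ^ 2 / c ^ 2
  have hA : 0 < A := by positivity
  have hd : (0:ℝ) < d := by exact_mod_cast hd1
  obtain ⟨r₀, hr0, hun⟩ := unif 𝓜 hcont (c / (2 * A * d^2)) (by positivity)
  refine ⟨r₀, hr0, fun z u hu w hw 𝒯 hT i => ?_⟩
  obtain ⟨huint, hudet, humin⟩ := hu
  have hq : ∀ z x, 0 ≤ x ⬝ᵥ (𝓜 z).mulVec x := fun z x =>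
    le_trans (by positivity) (hlow z x)
  have hmin : ∀ v, IsIntVec v → ¬ InLatticeSpan u i v →
      u i ⬝ᵥ (𝓜 z).mulVec (u i) ≤ v ⬝ᵥ (𝓜 z).mulVec v := fun v hv hs =>
    (Real.sqrt_le_sqrt_iff (hq z v)).1 (humin i v hv hs)
  have hui := not_span u hudet i
  have hdiff : ∀ x, |x ⬝ᵥ (𝓜 (z + toTorus w)).mulVec x - x ⬝ᵥ (𝓜 z).mulVec x| ≤
      c / (2 * A) * ‖x‖^2 := by
    intro x
    have := qsum (𝓜 (z + toTorus w) - 𝓜 z) x _ (fun i j => hun z w hw i j)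
    rw [Matrix.sub_mulVec, dotProduct_sub] at this
    refine this.trans_eq ?_
    field_simp
  have hub : u i ⬝ᵥ (𝓜 z).mulVec (u i) ≤ C := by
    have : ∃ j : Fin d, ¬ InLatticeSpan u i (Pi.single j 1) := by
      by_contra! h
      choose m hm using huint i
      apply hui
      have h1 := span_sum u i m (fun j => Pi.single j 1) (fun j _ => h j)
      convert h1 using 1
      ext k
      rw [Finset.sum_apply, hm]
      simp [Pi.single_apply]
    obtain ⟨j, hj⟩ := this
    refine (hmin _ (fun k => ?_) hj).trans ((hup z _).trans ?_)
    · by_cases h : k = j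
      · subst h; exact ⟨1, by simp⟩
      · exact ⟨0, by simp [h]⟩
    · have hn : ‖(Pi.single j 1 : Fin d → ℝ)‖ = 1 := by
        rw [Pi.norm_single]; exact norm_one
      rw [hn, one_pow, mul_one]
  have main : ∀ y : Fin d → ℝ, IsIntVec y → ¬ InLatticeSpan u i y →
      (∀ z, y ⬝ᵥ (𝓜 z).mulVec y = u i ⬝ᵥ (𝓜 z).mulVec (u i)) → IsMeshVertex 𝒯 y := by
    intro y hy hs hyq
    by_contra hnv
    obtain ⟨v, r, hv, hr, hr0, hvs, hle⟩ := key _ 𝒯 hT y hy u i hs hnv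
    have h1 := hmin v hv hvs
    rw [← hyq] at h1 hub
    have hr1 : c ≤ r ⬝ᵥ (𝓜 (z + toTorus w)).mulVec r := by
      have := hlow (z + toTorus w) r
      have h2 := one_le_pow₀ (n := 2) (int_norm r hr hr0)
      nlinarith
    have hyn : ‖y‖^2 ≤ C / c := by
      rw [le_div_iff₀ hc]
      linarith [hlow z y]
    have hvn : ‖v‖^2 ≤ C^2 / c^2 := by
      have h3 : c * ‖v‖^2 ≤ C * (C / c) :=
        (hlow (z + toTorus w) v).trans (by
          have := hup (z + toTorus w) y
          have h4 : C * ‖y‖^2 ≤ C * (C / c) := by gcongr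
          linarith)
      have : C^2 / c^2 = (C * (C / c)) / c := by field_simp
      rw [this, le_div_iff₀ hc]
      linarith
    have hy2 := (abs_le.1 (hdiff y)).2
    have hv2 := (abs_le.1 (hdiff v)).1
    have hfin : c / (2 * A) * ‖y‖^2 + c / (2 * A) * ‖v‖^2 ≤ c / 2 := by
      rw [← mul_add]
      calc _ ≤ c / (2 * A) * A := by
            have : ‖y‖^2 + ‖v‖^2 ≤ A := add_le_add hyn hvn
            gcongr
        _ = c / 2 := by field_simp
    linarith
  refine ⟨main _ (huint i) hui fun _ => rfl, main _ (fun k => ?_) ?_ fun _ => ?_⟩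
  · obtain ⟨m, hm⟩ := huint i k
    exact ⟨-m, by simp [hm]⟩
  · rintro ⟨e, he, h⟩
    refine hui ⟨-e, fun j hj => by simp [he j hj], ?_⟩
    rw [← neg_neg (u i), h]
    simp [Finset.sum_neg_distrib]
  · simp [Matrix.mulVec_neg]

end
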